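/- arXiv:cs/0602081 — 3 statements merged into one kernel-verified Lean document; each statement's English description precedes it below -/
import Mathlib

section
/- Let ξ ∈ (0,1) and let λ, ρ be degree distributions satisfying the successful decoding condition ξ·λ(1−ρ(1−x)) < x for all x ∈ (0, ξ]. Let k_c > 0 be a constant such that the maximal degree of ρ is at most k_c·a, where a is defined by 1/a = ∫₀¹ ρ(x) dx; set b = 1/a, R = 1 − (∫₀¹ρ)/(∫₀¹λ), and ΔR = (1−ξ) − R. Then for every x ∈ (0, ξ): (1 − λ^{-1}(x/ξ))/ρ(1−x) ≥ 1 − √(k_c)·B(ΔR, b, x), where B(ΔR, b, x) = √( 2ΔR / ((ξ+ΔR)(1−ξ)·ρ(1−x)) ). -/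
open scoped BigOperators

/-- A degree distribution: a real polynomial `γ(x) = ∑_{i=2}^{D} γ_i x^(i-1)` whose
coefficients are nonnegative and sum to `1`; `D` (the largest index with `γ_D ≠ 0`)
is called the maximal degree. -/
structure DegreeDist where
  c : ℕ → ℝ
  D : ℕ
  two_le_D : 2 ≤ D
  nonneg : ∀ i, 0 ≤ c i
  supp : ∀ i, c i ≠ 0 → 2 ≤ i ∧ i ≤ D
  cD_ne : c D ≠ 0
  sum_eq_one : ∑ i ∈ Finset.Icc 2 D, c i = 1

/-- Evaluation of a degree distribution at a real `x`. -/
noncomputable def DegreeDist.eval (γ : DegreeDist) (x : ℝ) : ℝ :=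
  ∑ i ∈ Finset.Icc 2 γ.D, γ.c i * x ^ (i - 1)

namespace DegreeDist

theorem continuous_eval (γ : DegreeDist) : Continuous γ.eval := by
  unfold DegreeDist.eval
  fun_prop

theorem contDiff_eval (γ : DegreeDist) : ContDiff ℝ 1 γ.eval := by
  unfold DegreeDist.eval
  fun_prop

theorem eval_zero (γ : DegreeDist) : γ.eval 0 = 0 := by
  refine Finset.sum_eq_zero fun i hi => ?_
  have hi' := (Finset.mem_Icc.1 hi).1
  rw [zero_pow (by omega), mul_zero]

theorem eval_one (γ : DegreeDist) : γ.eval 1 = 1 := by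
  simp [DegreeDist.eval, γ.sum_eq_one]

theorem eval_mono (γ : DegreeDist) {x y : ℝ} (hx : 0 ≤ x) (hxy : x ≤ y) :
    γ.eval x ≤ γ.eval y :=
  Finset.sum_le_sum fun i _ => mul_le_mul_of_nonneg_left (pow_le_pow_left₀ hx hxy _) (γ.nonneg i)

theorem eval_nonneg (γ : DegreeDist) {x : ℝ} (hx : 0 ≤ x) : 0 ≤ γ.eval x :=
  γ.eval_zero ▸ γ.eval_mono le_rfl hx

theorem eval_le_one (γ : DegreeDist) {x : ℝ} (hx : 0 ≤ x) (hx' : x ≤ 1) : γ.eval x ≤ 1 :=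
  γ.eval_one ▸ γ.eval_mono hx hx'

theorem eval_pos (γ : DegreeDist) {x : ℝ} (hx : 0 < x) : 0 < γ.eval x := by
  refine Finset.sum_pos' (fun i _ => mul_nonneg (γ.nonneg i) (by positivity))
    ⟨γ.D, Finset.mem_Icc.2 ⟨γ.two_le_D, le_rfl⟩, ?_⟩
  exact mul_pos (lt_of_le_of_ne (γ.nonneg _) γ.cD_ne.symm) (by positivity)

/-- A Bernoulli-type lower bound: a degree distribution lies above a line of slope
`D * γ(y₀) / y₀` through `(y₀, γ(y₀))`, to the left of `y₀`. -/
theorem eval_sub_le_eval (γ : DegreeDist) {y y₀ : ℝ} (hy : 0 ≤ y) (hyy : y ≤ y₀) (hy₀ : 0 < y₀) :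
    γ.eval y₀ - γ.D * γ.eval y₀ / y₀ * (y₀ - y) ≤ γ.eval y := by
  have hr : y / y₀ ≤ 1 := (div_le_one hy₀).2 hyy
  have hr0 : 0 ≤ y / y₀ := div_nonneg hy hy₀.le
  have key : γ.eval y₀ - γ.D * γ.eval y₀ / y₀ * (y₀ - y)
      = γ.eval y₀ * (1 - γ.D * (1 - y / y₀)) := by
    field_simp
  rw [key, DegreeDist.eval, DegreeDist.eval, Finset.sum_mul]
  refine Finset.sum_le_sum fun i hi => ?_
  have hiD : ((i - 1 : ℕ) : ℝ) ≤ γ.D := by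
    have := (Finset.mem_Icc.1 hi).2
    exact_mod_cast (by omega : i - 1 ≤ γ.D)
  have hB := one_add_mul_le_pow (a := y / y₀ - 1) (by linarith) (i - 1)
  rw [add_sub_cancel, div_pow, le_div_iff₀ (by positivity)] at hB
  rw [mul_assoc]
  refine mul_le_mul_of_nonneg_left (le_trans ?_ hB) (γ.nonneg i)
  rw [mul_comm]
  refine mul_le_mul_of_nonneg_right ?_ (by positivity)
  nlinarith [mul_nonneg (sub_nonneg.2 hiD) (sub_nonneg.2 hr)]

theorem integral_eval_pos (γ : DegreeDist) : 0 < ∫ x in (0:ℝ)..1, γ.eval x :=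
  intervalIntegral.intervalIntegral_pos_of_pos_on (γ.continuous_eval.intervalIntegrable _ _)
    (fun _ hx => γ.eval_pos hx.1) one_pos

theorem monotoneOn_inverse (γ : DegreeDist) {g : ℝ → ℝ}
    (hmaps : ∀ y ∈ Set.Icc (0:ℝ) 1, g y ∈ Set.Icc (0:ℝ) 1)
    (hright : ∀ y ∈ Set.Icc (0:ℝ) 1, γ.eval (g y) = y) : MonotoneOn g (Set.Icc 0 1) := by
  intro x hx y hy hxy
  by_contra! h
  have := γ.eval_mono (hmaps y hy).1 h.le
  rw [hright x hx, hright y hy] at this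
  rw [le_antisymm hxy this] at h
  exact lt_irrefl _ h

theorem integral_inverse (γ : DegreeDist) {g : ℝ → ℝ}
    (hleft : ∀ x ∈ Set.Icc (0:ℝ) 1, g (γ.eval x) = x) :
    ∫ y in (0:ℝ)..1, g y = 1 - ∫ x in (0:ℝ)..1, γ.eval x := by
  have hd : ∀ x, HasDerivAt γ.eval (deriv γ.eval x) x := fun x =>
    (γ.contDiff_eval.differentiable one_ne_zero x).hasDerivAt
  have hc : Continuous (deriv γ.eval) := γ.contDiff_eval.continuous_deriv le_rfl
  have hnn : ∀ x ∈ Set.Ioo (0:ℝ) 1, 0 ≤ deriv γ.eval x := by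
    intro x hx
    rw [← derivWithin_of_mem_nhds (Ici_mem_nhds hx.1)]
    exact MonotoneOn.derivWithin_nonneg fun a ha b _ hab => γ.eval_mono ha hab
  have h := MeasureTheory.integral_Icc_deriv_smul_of_deriv_nonneg (g := g)
    γ.continuous_eval.continuousOn (fun x _ => hd x) hnn zero_le_one
  rw [γ.eval_zero, γ.eval_one, MeasureTheory.integral_Icc_eq_integral_Ioc,
    MeasureTheory.integral_Icc_eq_integral_Ioc, ← intervalIntegral.integral_of_le zero_le_one,
    ← intervalIntegral.integral_of_le zero_le_one] at h
  have hparts := intervalIntegral.integral_mul_deriv_eq_deriv_mul (a := 0) (b := 1)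
    (fun x _ => hasDerivAt_id x) (fun x _ => hd x)
    (continuous_const.intervalIntegrable _ _) (hc.intervalIntegrable _ _)
  simp only [id, γ.eval_one, one_mul, zero_mul, sub_zero] at hparts
  rw [← h, ← hparts]
  refine intervalIntegral.integral_congr fun x hx => ?_
  rw [Set.uIcc_of_le zero_le_one] at hx
  simp only [hleft x hx, smul_eq_mul, mul_comm]

end DegreeDist

/-- A nonnegative function dominating a line of slope `-s` starting at height `δ` encloses at least
the area of the corresponding triangle. -/
theorem sq_div_le_integral_of_line_le {f : ℝ → ℝ} {δ s x₀ : ℝ}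
    (hf : IntervalIntegrable f MeasureTheory.volume 0 1) (hnn : ∀ x ∈ Set.Icc (0:ℝ) 1, 0 ≤ f x)
    (hδ : 0 ≤ δ) (hs : 0 < s) (hx₀ : 0 ≤ x₀) (hend : x₀ + δ / s ≤ 1)
    (hline : ∀ x ∈ Set.Icc x₀ 1, δ - s * (x - x₀) ≤ f x) :
    δ ^ 2 / (2 * s) ≤ ∫ x in (0:ℝ)..1, f x := by
  have hm : x₀ ≤ x₀ + δ / s := le_add_of_nonneg_right (by positivity)
  have htri : ∫ x in x₀..(x₀ + δ / s), (δ - s * (x - x₀)) = δ ^ 2 / (2 * s) := by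
    rw [intervalIntegral.integral_comp_sub_right (fun x => δ - s * x),
      intervalIntegral.integral_sub (by simp) ((by fun_prop : Continuous _).intervalIntegrable _ _),
      intervalIntegral.integral_const_mul, integral_id, intervalIntegral.integral_const,
      smul_eq_mul]
    field_simp
    ring
  rw [← htri]
  calc _ ≤ ∫ x in x₀..(x₀ + δ / s), f x := by
        refine intervalIntegral.integral_mono_on hm
          ((by fun_prop : Continuous _).intervalIntegrable _ _) (hf.mono_set ?_)
          fun x hx => hline x ⟨hx.1, hx.2.trans hend⟩
        rw [Set.uIcc_of_le hm, Set.uIcc_of_le zero_le_one]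
        exact Set.Icc_subset_Icc hx₀ hend
    _ ≤ _ := by
        refine intervalIntegral.integral_mono_interval hx₀ hm hend ?_ hf
        refine (MeasureTheory.ae_restrict_iff' measurableSet_Ioc).2 (.of_forall fun x hx => ?_)
        exact hnn x (Set.Ioc_subset_Icc_self hx)

/-- under the successful decoding condition,
`(1 − λ⁻¹(x/ξ))/ρ(1−x) ≥ 1 − √k_c·B(ΔR,b,x)` on `(0, ξ)`, where
`B(ΔR,b,x) = √(2ΔR/((ξ+ΔR)(1−ξ)ρ(1−x)))`. -/
theorem stmt4 (ξ a kc b R dR : ℝ) (hξ : ξ ∈ Set.Ioo (0:ℝ) 1) (hkc : 0 < kc)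
    (lam ρ : DegreeDist)
    (linv : ℝ → ℝ)
    (hmaps : ∀ y ∈ Set.Icc (0:ℝ) 1, linv y ∈ Set.Icc (0:ℝ) 1)
    (hleft : ∀ x ∈ Set.Icc (0:ℝ) 1, linv (lam.eval x) = x)
    (hright : ∀ y ∈ Set.Icc (0:ℝ) 1, lam.eval (linv y) = y)
    (ha : 1 / a = ∫ x in (0:ℝ)..1, ρ.eval x)
    (hb : b = 1 / a)
    (hR : R = 1 - (∫ x in (0:ℝ)..1, ρ.eval x) / (∫ x in (0:ℝ)..1, lam.eval x))
    (hdR : dR = (1 - ξ) - R)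
    (hdeg : (ρ.D : ℝ) ≤ kc * a)
    (hdec : ∀ x ∈ Set.Ioc (0:ℝ) ξ, ξ * lam.eval (1 - ρ.eval (1 - x)) < x) :
    ∀ x ∈ Set.Ioo (0:ℝ) ξ,
      1 - Real.sqrt kc * Real.sqrt (2 * dR / ((ξ + dR) * (1 - ξ) * ρ.eval (1 - x))) ≤
        (1 - linv (x / ξ)) / ρ.eval (1 - x) := by
  intro x₀ hx₀
  obtain ⟨hξ0, hξ1⟩ := hξ
  have hIρ := ρ.integral_eval_pos
  have hIl := lam.integral_eval_pos
  set Iρ := ∫ x in (0:ℝ)..1, ρ.eval x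
  set Il := ∫ x in (0:ℝ)..1, lam.eval x
  have hmono := lam.monotoneOn_inverse hmaps hright
  have hlinv1 : linv 1 = 1 := by
    simpa [lam.eval_one] using hleft 1 (by simp)
  have hmin : ∀ x ∈ Set.Icc (0:ℝ) 1, min (x / ξ) 1 ∈ Set.Icc (0:ℝ) 1 := fun x hx =>
    ⟨le_min (div_nonneg hx.1 hξ0.le) zero_le_one, min_le_right _ _⟩
  have hGmono : MonotoneOn (fun x => linv (min (x / ξ) 1)) (Set.Icc 0 1) := fun x hx y hy hxy =>
    hmono (hmin x hx) (hmin y hy) (min_le_min_right _ (by gcongr))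
  have hGint : IntervalIntegrable (fun x => linv (min (x / ξ) 1)) MeasureTheory.volume 0 1 :=
    MonotoneOn.intervalIntegrable (by rwa [Set.uIcc_of_le zero_le_one])
  have hG : ∫ x in (0:ℝ)..1, linv (min (x / ξ) 1) = 1 - ξ * Il := by
    have hsub : ∀ {u v : ℝ}, 0 ≤ u → u ≤ v → v ≤ 1 →
        IntervalIntegrable (fun x => linv (min (x / ξ) 1)) MeasureTheory.volume u v := by
      intro u v hu huv hv
      refine hGint.mono_set ?_
      rw [Set.uIcc_of_le huv, Set.uIcc_of_le zero_le_one]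
      exact Set.Icc_subset_Icc hu hv
    rw [← intervalIntegral.integral_add_adjacent_intervals (hsub le_rfl hξ0.le hξ1.le)
      (hsub hξ0.le hξ1.le le_rfl)]
    have h1 : ∫ x in (0:ℝ)..ξ, linv (min (x / ξ) 1) = ∫ x in (0:ℝ)..ξ, linv (x / ξ) := by
      refine intervalIntegral.integral_congr fun x hx => ?_
      rw [Set.uIcc_of_le hξ0.le] at hx
      simp only [min_eq_left ((div_le_one hξ0).2 hx.2)]
    have h2 : ∫ x in ξ..1, linv (min (x / ξ) 1) = ∫ x in ξ..1, (1:ℝ) := by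
      refine intervalIntegral.integral_congr fun x hx => ?_
      rw [Set.uIcc_of_le hξ1.le] at hx
      simp only [min_eq_right ((one_le_div hξ0).2 hx.1), hlinv1]
    rw [h1, h2, intervalIntegral.integral_comp_div _ hξ0.ne', zero_div, div_self hξ0.ne',
      lam.integral_inverse hleft, intervalIntegral.integral_const, smul_eq_mul, smul_eq_mul]
    ring
  have hρint : IntervalIntegrable (fun x => ρ.eval (1 - x)) MeasureTheory.volume 0 1 :=
    (ρ.continuous_eval.comp (by fun_prop)).intervalIntegrable _ _
  set f : ℝ → ℝ := fun x => ρ.eval (1 - x) - (1 - linv (min (x / ξ) 1)) with hf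
  have hfint : IntervalIntegrable f MeasureTheory.volume 0 1 :=
    hρint.sub (intervalIntegrable_const.sub hGint)
  have hfval : ∫ x in (0:ℝ)..1, f x = Iρ - ξ * Il := by
    rw [hf, intervalIntegral.integral_sub hρint (intervalIntegrable_const.sub hGint),
      intervalIntegral.integral_sub intervalIntegrable_const hGint, hG,
      intervalIntegral.integral_comp_sub_left (fun x => ρ.eval x)]
    simp [Iρ]
  have hfnn : ∀ x ∈ Set.Icc (0:ℝ) 1, 0 ≤ f x := by
    intro x hx
    simp only [hf]
    rcases le_or_gt ξ x with hxξ | hxξ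
    · rw [min_eq_right ((one_le_div hξ0).2 hxξ), hlinv1]
      linarith [ρ.eval_nonneg (sub_nonneg.2 hx.2)]
    rw [min_eq_left ((div_le_one hξ0).2 hxξ.le)]
    have hmem : x / ξ ∈ Set.Icc (0:ℝ) 1 := ⟨div_nonneg hx.1 hξ0.le, (div_le_one hξ0).2 hxξ.le⟩
    rcases hx.1.eq_or_lt with rfl | hx0
    · rw [sub_zero, ρ.eval_one]
      linarith [(hmaps _ hmem).1]
    by_contra! h
    have h1 := lam.eval_mono (y := 1 - ρ.eval (1 - x)) (hmaps _ hmem).1 (by linarith)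
    rw [hright _ hmem, div_le_iff₀ hξ0] at h1
    linarith [hdec x ⟨hx0, hxξ.le⟩]
  obtain ⟨hx0, hxξ⟩ := hx₀
  have hx01 : x₀ ∈ Set.Icc (0:ℝ) 1 := ⟨hx0.le, (hxξ.trans hξ1).le⟩
  have hfx₀ : f x₀ = ρ.eval (1 - x₀) - (1 - linv (x₀ / ξ)) := by
    simp only [hf, min_eq_left ((div_le_one hξ0).2 hxξ.le)]
  have hg0 : 0 ≤ 1 - linv (x₀ / ξ) :=
    sub_nonneg.2 (hmaps _ ⟨div_nonneg hx0.le hξ0.le, (div_le_one hξ0).2 hxξ.le⟩).2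
  have hy0 : 0 < 1 - x₀ := by linarith
  have hr0 := ρ.eval_pos hy0
  have hD : (1:ℝ) ≤ ρ.D := by exact_mod_cast one_le_two.trans ρ.two_le_D
  have hs : 0 < ρ.D * ρ.eval (1 - x₀) / (1 - x₀) := by positivity
  have hδ := hfnn x₀ hx01
  have harea := sq_div_le_integral_of_line_le hfint hfnn hδ hs hx0.le
    (by
      rw [← le_sub_iff_add_le', div_le_iff₀ hs, mul_div_cancel₀ _ hy0.ne']
      nlinarith)
    (by
      intro x hx
      have h1 := ρ.eval_sub_le_eval (sub_nonneg.2 hx.2) (sub_le_sub_left hx.1 1) hy0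
      have h2 := hGmono hx01 ⟨hx0.le.trans hx.1, hx.2⟩ hx.1
      simp only [hf] at h2 ⊢
      rw [show 1 - x₀ - (1 - x) = x - x₀ by ring] at h1
      linarith)
  rw [hfval] at harea
  set r := ρ.eval (1 - x₀)
  have hsum : ξ + dR = Iρ / Il := by rw [hdR, hR]; ring
  have hdR' : dR = (Iρ - ξ * Il) / Il := by rw [eq_div_iff hIl.ne']; field_simp at hsum; linarith
  have ha0 : a ≠ 0 := by
    rintro rfl
    simp at ha
    exact hIρ.ne ha
  have hDI : ρ.D * Iρ ≤ kc := by
    rw [← ha] at hIρ ⊢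
    have : 0 < a := one_div_pos.1 hIρ
    rw [mul_one_div, div_le_iff₀ this]
    exact hdeg
  have hA : 0 ≤ Iρ - ξ * Il := le_trans (by positivity) harea
  have hX : 2 * dR / ((ξ + dR) * (1 - ξ) * r) = 2 * (Iρ - ξ * Il) / (Iρ * (1 - ξ) * r) := by
    rw [hsum, hdR']
    have : 1 - ξ ≠ 0 := by linarith
    field_simp
  rw [hX, ← Real.sqrt_mul hkc.le, sub_le_comm]
  refine Real.le_sqrt_of_sq_le ?_
  have hfr : 1 - (1 - linv (x₀ / ξ)) / r = f x₀ / r := by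
    rw [hfx₀]
    field_simp
  have hξ' : 0 < 1 - ξ := by linarith
  rw [hfr, div_pow, div_le_iff₀ (by positivity)]
  rw [div_le_iff₀ (by positivity)] at harea
  calc f x₀ ^ 2 ≤ (Iρ - ξ * Il) * (2 * (ρ.D * r / (1 - x₀))) := harea
    _ ≤ (Iρ - ξ * Il) * (2 * (kc / Iρ * r / (1 - ξ))) := by
        gcongr
        exact (le_div_iff₀ hIρ).2 hDI
    _ = _ := by field_simp
end

section
/- Let γ(x) = ∑_{i'} γ_{i'} x^{i'−1} be a degree distribution with average degree a (that is, ∫₀¹ γ(x) dx = 1/a) and maximal degree d ≥ 3. Let i be an integer with 1 < i < d such that γ_i > 0 and γ_{i+2} > 0. Then for all sufficiently small β > 0, the polynomial γ̂(x) = γ(x) + β·x^i − (i/(2(i+1)))·β·x^{i−1} − ((i+2)/(2(i+1)))·β·x^{i+1} is again a degree distribution with the same average degree a and the same maximal degree d, and moreover γ(x) < γ̂(x) for all x with i/(i+2) < x < 1, while γ(x) > γ̂(x) for all x with 0 < x < i/(i+2). -/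
open scoped BigOperators

theorem DegreeDist.continuous_eval_s15 (γ : DegreeDist) : Continuous γ.eval := by
  unfold DegreeDist.eval
  fun_prop

/-- The coefficients of `x ^ i - i / (2 (i + 1)) x ^ (i - 1) - (i + 2) / (2 (i + 1)) x ^ (i + 1)`,
where index `j` carries the coefficient of `x ^ (j - 1)`. -/
noncomputable def perturbCoeff (i j : ℕ) : ℝ :=
  (if j = i + 1 then 1 else 0) - (if j = i then (i : ℝ) / (2 * ((i : ℝ) + 1)) else 0)
    - (if j = i + 2 then ((i : ℝ) + 2) / (2 * ((i : ℝ) + 1)) else 0)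

/-- The polynomial with coefficients `perturbCoeff i`. -/
noncomputable def perturbEval (i : ℕ) (x : ℝ) : ℝ :=
  x ^ i - (i : ℝ) / (2 * ((i : ℝ) + 1)) * x ^ (i - 1)
    - ((i : ℝ) + 2) / (2 * ((i : ℝ) + 1)) * x ^ (i + 1)

theorem sum_perturbCoeff_mul {i n : ℕ} (hi : 2 ≤ i) (hn : i + 2 ≤ n) (f : ℕ → ℝ) :
    ∑ j ∈ Finset.Icc 2 n, perturbCoeff i j * f j =
      f (i + 1) - (i : ℝ) / (2 * ((i : ℝ) + 1)) * f i
        - ((i : ℝ) + 2) / (2 * ((i : ℝ) + 1)) * f (i + 2) := by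
  have h₀ : i ∈ Finset.Icc 2 n := by grind
  have h₁ : i + 1 ∈ Finset.Icc 2 n := by grind
  have h₂ : i + 2 ∈ Finset.Icc 2 n := by grind
  simp only [perturbCoeff, sub_mul, ite_mul, zero_mul, one_mul, Finset.sum_sub_distrib,
    Finset.sum_ite_eq', h₀, h₁, h₂, if_true]

theorem perturbEval_eq {i : ℕ} (hi : 1 ≤ i) (x : ℝ) :
    perturbEval i x =
      x ^ (i - 1) / (2 * ((i : ℝ) + 1)) * ((1 - x) * (((i : ℝ) + 2) * x - i)) := by
  obtain ⟨k, rfl⟩ := Nat.exists_eq_add_of_le' hi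
  have : ((k + 1 : ℕ) : ℝ) + 1 ≠ 0 := by positivity
  simp only [perturbEval, Nat.add_sub_cancel]
  field_simp
  ring

theorem perturbEval_pos {i : ℕ} (hi : 1 ≤ i) {x : ℝ} (hx : (i : ℝ) / ((i : ℝ) + 2) < x)
    (hx1 : x < 1) : 0 < perturbEval i x := by
  have hx0 : 0 < x := lt_of_le_of_lt (by positivity) hx
  rw [div_lt_iff₀ (by positivity)] at hx
  rw [perturbEval_eq hi]
  exact mul_pos (by positivity) (mul_pos (by linarith) (by linarith))

theorem perturbEval_neg {i : ℕ} (hi : 1 ≤ i) {x : ℝ} (hx0 : 0 < x)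
    (hx : x < (i : ℝ) / ((i : ℝ) + 2)) : perturbEval i x < 0 := by
  have hx1 : x < 1 := hx.trans ((div_lt_one (by positivity)).2 (by linarith))
  rw [lt_div_iff₀ (by positivity)] at hx
  rw [perturbEval_eq hi]
  exact mul_neg_of_pos_of_neg (by positivity)
    (mul_neg_of_pos_of_neg (by linarith) (by linarith))

theorem continuous_perturbEval (i : ℕ) : Continuous (perturbEval i) := by
  unfold perturbEval
  fun_prop

theorem integral_perturbEval {i : ℕ} (hi : 1 ≤ i) : ∫ x in (0 : ℝ)..1, perturbEval i x = 0 := by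
  obtain ⟨k, rfl⟩ := Nat.exists_eq_add_of_le' hi
  simp only [perturbEval, Nat.add_sub_cancel]
  rw [intervalIntegral.integral_sub, intervalIntegral.integral_sub,
    intervalIntegral.integral_const_mul, intervalIntegral.integral_const_mul,
    integral_pow, integral_pow, integral_pow]
  · simp only [one_pow, ne_eq, Nat.add_eq_zero_iff, one_ne_zero, and_false, not_false_eq_true,
      zero_pow, sub_zero]
    push_cast
    field_simp
    ring
  all_goals exact Continuous.intervalIntegrable (by fun_prop) _ _

theorem perturbCoeff_nonneg {i j : ℕ} (h₀ : j ≠ i) (h₂ : j ≠ i + 2) : 0 ≤ perturbCoeff i j := by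
  simp only [perturbCoeff, if_neg h₀, if_neg h₂, sub_zero]
  split_ifs <;> norm_num

theorem neg_one_le_perturbCoeff (i j : ℕ) : -1 ≤ perturbCoeff i j := by
  have hu : (i : ℝ) / (2 * ((i : ℝ) + 1)) ≤ 1 := by
    rw [div_le_one (by positivity)]
    linarith [(i.cast_nonneg : (0 : ℝ) ≤ i)]
  have hv : ((i : ℝ) + 2) / (2 * ((i : ℝ) + 1)) ≤ 1 := by
    rw [div_le_one (by positivity)]
    linarith [(i.cast_nonneg : (0 : ℝ) ≤ i)]
  unfold perturbCoeff
  split_ifs <;> first | omega | linarith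

theorem add_mul_perturbCoeff_nonneg {c : ℕ → ℝ} (hc : ∀ j, 0 ≤ c j) {i : ℕ} {β : ℝ} (hβ : 0 ≤ β)
    (h₀ : β ≤ c i) (h₂ : β ≤ c (i + 2)) (j : ℕ) : 0 ≤ c j + β * perturbCoeff i j := by
  by_cases h : j = i ∨ j = i + 2
  · have hj : β ≤ c j := by rcases h with rfl | rfl <;> assumption
    nlinarith [neg_one_le_perturbCoeff i j]
  · push Not at h
    exact add_nonneg (hc j) (mul_nonneg hβ (perturbCoeff_nonneg h.1 h.2))

theorem add_mul_perturbCoeff_pos {c : ℕ → ℝ} {i j : ℕ} {β : ℝ} (hβ : 0 ≤ β) (hj : 0 < c j)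
    (h₀ : β < c i) (h₂ : β < c (i + 2)) : 0 < c j + β * perturbCoeff i j := by
  by_cases h : j = i ∨ j = i + 2
  · have hj : β < c j := by rcases h with rfl | rfl <;> assumption
    nlinarith [neg_one_le_perturbCoeff i j]
  · push Not at h
    exact add_pos_of_pos_of_nonneg hj (mul_nonneg hβ (perturbCoeff_nonneg h.1 h.2))

/-- The degree distribution `γ + β • perturbCoeff i`. -/
noncomputable def DegreeDist.perturb (γ : DegreeDist) {i : ℕ} {β : ℝ} (hi : 2 ≤ i)
    (hiD : i + 2 ≤ γ.D) (hβ : 0 ≤ β) (h₀ : β < γ.c i) (h₂ : β < γ.c (i + 2)) : DegreeDist where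
  c j := γ.c j + β * perturbCoeff i j
  D := γ.D
  two_le_D := γ.two_le_D
  nonneg := add_mul_perturbCoeff_nonneg γ.nonneg hβ h₀.le h₂.le
  supp j hj := by
    by_cases hc : γ.c j = 0
    · have : perturbCoeff i j ≠ 0 := by rintro h; simp [hc, h] at hj
      unfold perturbCoeff at this
      split_ifs at this <;> first | omega | simp at this
    · exact γ.supp j hc
  cD_ne := (add_mul_perturbCoeff_pos hβ ((γ.nonneg _).lt_of_ne' γ.cD_ne) h₀ h₂).ne'
  sum_eq_one := by
    have h := sum_perturbCoeff_mul hi hiD fun _ => 1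
    simp only [mul_one] at h
    rw [Finset.sum_add_distrib, ← Finset.mul_sum, γ.sum_eq_one, h]
    field_simp
    ring

theorem DegreeDist.eval_perturb (γ : DegreeDist) {i : ℕ} {β : ℝ} (hi : 2 ≤ i)
    (hiD : i + 2 ≤ γ.D) (hβ : 0 ≤ β) (h₀ : β < γ.c i) (h₂ : β < γ.c (i + 2)) (x : ℝ) :
    (γ.perturb hi hiD hβ h₀ h₂).eval x = γ.eval x + β * perturbEval i x := by
  have h := sum_perturbCoeff_mul hi hiD fun j => x ^ (j - 1)
  simp only [DegreeDist.eval, DegreeDist.perturb, add_mul, Finset.sum_add_distrib, mul_assoc,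
    ← Finset.mul_sum, h]
  rfl


/-- perturbing a degree distribution `γ` (with `γ_i, γ_{i+2} > 0`,
`1 < i < d`) by `β x^i − (i/(2(i+1)))β x^{i−1} − ((i+2)/(2(i+1)))β x^{i+1}` for
sufficiently small `β > 0` yields another degree distribution `γ̂` with the same
average and maximal degrees, with `γ < γ̂` on `(i/(i+2), 1)` and `γ > γ̂` on
`(0, i/(i+2))`. -/
theorem stmt15 (γ : DegreeDist) (a : ℝ)
    (haa : 1 / a = ∫ x in (0:ℝ)..1, γ.eval x)
    (hd : 3 ≤ γ.D) (i : ℕ) (hi1 : 1 < i) (hi2 : i < γ.D)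
    (hγi : 0 < γ.c i) (hγi2 : 0 < γ.c (i + 2)) :
    ∃ β₀ > (0:ℝ), ∀ β : ℝ, 0 < β → β ≤ β₀ →
      ∃ γh : DegreeDist,
        (∀ x : ℝ, γh.eval x =
            γ.eval x + β * x ^ i
              - (i : ℝ) / (2 * ((i : ℝ) + 1)) * β * x ^ (i - 1)
              - ((i : ℝ) + 2) / (2 * ((i : ℝ) + 1)) * β * x ^ (i + 1)) ∧
        γh.D = γ.D ∧
        (1 / a = ∫ x in (0:ℝ)..1, γh.eval x) ∧
        (∀ x : ℝ, (i : ℝ) / ((i : ℝ) + 2) < x → x < 1 → γ.eval x < γh.eval x) ∧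
        (∀ x : ℝ, 0 < x → x < (i : ℝ) / ((i : ℝ) + 2) → γh.eval x < γ.eval x) := by
  have hiD : i + 2 ≤ γ.D := (γ.supp _ hγi2.ne').2
  refine ⟨min (γ.c i) (γ.c (i + 2)) / 2, by positivity, fun β hβ hβ₀ => ?_⟩
  have hm : 0 < min (γ.c i) (γ.c (i + 2)) := by positivity
  have h₀ : β < γ.c i := by linarith [min_le_left (γ.c i) (γ.c (i + 2))]
  have h₂ : β < γ.c (i + 2) := by linarith [min_le_right (γ.c i) (γ.c (i + 2))]
  have heval := γ.eval_perturb hi1 hiD hβ.le h₀ h₂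
  refine ⟨γ.perturb hi1 hiD hβ.le h₀ h₂, fun x => ?_, rfl, ?_, fun x hx hx1 => ?_,
    fun x hx0 hx => ?_⟩
  · rw [heval, perturbEval]
    ring
  · simp only [heval]
    rw [intervalIntegral.integral_add (γ.continuous_eval_s15.intervalIntegrable _ _)
      (((continuous_perturbEval i).const_mul β).intervalIntegrable _ _),
      intervalIntegral.integral_const_mul, integral_perturbEval hi1.le, mul_zero, add_zero, haa]
  · rw [heval]
    exact lt_add_of_pos_right _ (mul_pos hβ (perturbEval_pos hi1.le hx hx1))
  · rw [heval]
    exact add_lt_of_neg_right _ (mul_neg_of_pos_of_neg hβ (perturbEval_neg hi1.le hx0 hx))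
end

section
/- Let d be a positive integer with d ≥ 3, let a be a non-integer real number with 2 ≤ a < d, and let i = ⌊a⌋. Let x be a real number with x > 1 − 2/(d+1) and x < 1. Then among all degree distributions γ with maximal degree at most d and average degree a (that is, ∫₀¹ γ = 1/a), the value γ(x) is maximized by the unique two-term distribution γ̄(x) = γ̄_i x^{i−1} + γ̄_{i+1} x^i with γ̄_i + γ̄_{i+1} = 1 and γ̄_i/i + γ̄_{i+1}/(i+1) = 1/a: for every degree distribution γ with maximal degree at most d and ∫₀¹ γ = 1/a, γ(x) ≤ γ̄(x). -/
open scoped BigOperators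

/-- The increments of `j ↦ x ^ j`, rescaled by those of `j ↦ 1 / (j + 1)`, are monotone as long
as `(n + 1) / (n + 3) ≤ x`. -/
lemma mul_mul_pow_mono {N : ℕ} {x : ℝ} (hx0 : 0 ≤ x)
    (hx : ∀ n : ℕ, n < N → (n : ℝ) + 1 ≤ (n + 3) * x) {m n : ℕ} (hmn : m ≤ n) (hn : n ≤ N) :
    ((m : ℝ) + 1) * (m + 2) * x ^ m ≤ (n + 1) * (n + 2) * x ^ n := by
  induction n, hmn using Nat.le_induction with
  | base => exact le_rfl
  | succ n hmn ih =>
    refine (ih (by omega)).trans ?_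
    have h := mul_le_mul_of_nonneg_left (hx n (by omega))
      (by positivity : 0 ≤ ((n : ℝ) + 2) * x ^ n)
    push_cast
    rw [pow_succ]
    linarith

/-- The chord through `(1 / (m + 1), x ^ m)` and `(1 / (m + 2), x ^ (m + 1))` lies above all the
points `(1 / (n + 1), x ^ n)`. -/
lemma pow_le_chord {N : ℕ} {x : ℝ} (hx0 : 0 ≤ x) (hx1 : x ≤ 1)
    (hx : ∀ n : ℕ, n < N → (n : ℝ) + 1 ≤ (n + 3) * x) {m n : ℕ} (hm : m ≤ N) (hn : n ≤ N + 1) :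
    x ^ n ≤ x ^ m - (m + 1) * (m + 2) * x ^ m * (1 - x) * (1 / (m + 1) - 1 / (n + 1)) := by
  have key (k : ℕ) : (1 / ((k : ℝ) + 1) - 1 / (k + 1 + 1)) * ((k + 1) * (k + 2) * x ^ k) * (1 - x)
      = x ^ k - x ^ (k + 1) := by
    field_simp
    ring
  have hpos (k : ℕ) : 0 ≤ 1 / ((k : ℝ) + 1) - 1 / (k + 1 + 1) :=
    sub_nonneg.2 (one_div_le_one_div_of_le (by positivity) (by linarith))
  rcases le_total m n with h | h
  · induction n, h using Nat.le_induction with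
    | base => simp
    | succ n hmn ih =>
      have h1 := ih (by omega)
      have h2 := mul_le_mul_of_nonneg_right (mul_le_mul_of_nonneg_left
        (mul_mul_pow_mono hx0 hx hmn (by omega)) (hpos n)) (sub_nonneg.2 hx1)
      rw [key n] at h2
      push_cast
      linarith
  · induction h using Nat.decreasingInduction with
    | self => simp
    | of_succ n hnm ih =>
      have h1 := ih (by omega)
      have h2 := mul_le_mul_of_nonneg_right (mul_le_mul_of_nonneg_left
        (mul_mul_pow_mono hx0 hx hnm.le hm) (hpos n)) (sub_nonneg.2 hx1)
      rw [key n] at h2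
      push_cast at h1
      linarith

lemma DegreeDist.integral_eval (γ : DegreeDist) :
    ∫ t in (0 : ℝ)..1, γ.eval t = ∑ j ∈ Finset.Icc 2 γ.D, γ.c j / j := by
  unfold DegreeDist.eval
  rw [intervalIntegral.integral_finsetSum
    fun j _ => (by fun_prop : Continuous fun t : ℝ => γ.c j * t ^ (j - 1)).intervalIntegrable _ _]
  refine Finset.sum_congr rfl fun j hj => ?_
  obtain ⟨k, rfl⟩ : ∃ k, j = k + 1 := ⟨j - 1, by have := (Finset.mem_Icc.1 hj).1; omega⟩
  simp [integral_pow, div_eq_mul_inv]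

/-- for `x > 1 − 2/(d+1)`, among degree distributions with maximal
degree at most `d` and average degree `a` (non-integer, `2 ≤ a < d`), the value
`γ(x)` is maximized by the two-term distribution supported on `⌊a⌋` and `⌊a⌋+1`. -/
theorem stmt16 (d : ℕ) (hd : 3 ≤ d) (a : ℝ) (ha2 : 2 ≤ a) (had : a < d)
    (hnotint : ∀ m : ℤ, (m : ℝ) ≠ a) (i : ℕ) (hi : i = ⌊a⌋₊)
    (x : ℝ) (hx1 : 1 - 2 / ((d : ℝ) + 1) < x) (hx2 : x < 1)
    (ci ci1 : ℝ) (hci : 0 ≤ ci) (hci1 : 0 ≤ ci1)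
    (hsum : ci + ci1 = 1)
    (havg : ci / (i : ℝ) + ci1 / ((i : ℝ) + 1) = 1 / a) :
    ∀ γ : DegreeDist, γ.D ≤ d → (∫ t in (0:ℝ)..1, γ.eval t) = 1 / a →
      γ.eval x ≤ ci * x ^ (i - 1) + ci1 * x ^ i := by
  intro γ hD hint
  rw [γ.integral_eval] at hint
  have hi2 : 2 ≤ i := hi ▸ Nat.le_floor (by exact_mod_cast ha2)
  have hid : i < d := hi ▸ (Nat.floor_lt (by linarith)).2 had
  obtain ⟨m, rfl⟩ : ∃ m, i = m + 1 := ⟨i - 1, by omega⟩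
  obtain ⟨N, rfl⟩ : ∃ N, d = N + 2 := ⟨d - 2, by omega⟩
  push_cast at hx1 havg
  have hN : (0 : ℝ) < N + 2 + 1 := by positivity
  have hx1' : (N : ℝ) + 1 ≤ (N + 3) * x := by
    have h := mul_lt_mul_of_pos_left hx1 hN
    field_simp at h
    linarith
  have hx0 : 0 ≤ x := by
    by_contra! h
    nlinarith
  have hx (n : ℕ) (hn : n < N) : (n : ℝ) + 1 ≤ (n + 3) * x := by
    have : (n : ℝ) ≤ N := by exact_mod_cast hn.le
    nlinarith
  set β : ℝ := (m + 1) * (m + 2) * x ^ m * (1 - x) with hβ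
  have hterm : ∀ j ∈ Finset.Icc 2 γ.D,
      γ.c j * x ^ (j - 1) ≤ (x ^ m - β / (m + 1)) * γ.c j + β * (γ.c j / j) := by
    intro j hj
    obtain ⟨hj2, hjD⟩ := Finset.mem_Icc.1 hj
    obtain ⟨k, rfl⟩ : ∃ k, j = k + 1 := ⟨j - 1, by omega⟩
    have h := mul_le_mul_of_nonneg_left
      (pow_le_chord hx0 hx2.le hx (by omega : m ≤ N) (by omega : k ≤ N + 1)) (γ.nonneg (k + 1))
    rw [← hβ] at h
    push_cast
    refine h.trans_eq ?_
    ring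
  calc γ.eval x ≤ ∑ j ∈ Finset.Icc 2 γ.D,
        ((x ^ m - β / (m + 1)) * γ.c j + β * (γ.c j / j)) := Finset.sum_le_sum hterm
    _ = (x ^ m - β / (m + 1)) * (ci + ci1) + β * (ci / (m + 1) + ci1 / (m + 1 + 1)) := by
      rw [Finset.sum_add_distrib, ← Finset.mul_sum, ← Finset.mul_sum, γ.sum_eq_one, hint, hsum,
        havg]
    _ = ci * x ^ (m + 1 - 1) + ci1 * x ^ (m + 1) := by
      rw [hβ, Nat.add_sub_cancel]
      field_simp
      ring
end
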